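/- Let n ≥ 2 and Q = Σ_{0 ≤ i < j < k ≤ n} x_i x_j x_k ∈ ℂ[x₀,…,x_n]. Then the degree-n graded piece J_{Q,n} of the Jacobian ideal of Q equals the linear span of all monomials of degree n in x₀,…,x_n other than the pure powers x₀ⁿ, …, x_nⁿ. -/

import Mathlib

open MvPolynomial

/-- The Jacobian ideal of `F`. -/
noncomputable def jacobianIdeal {N : ℕ} (F : MvPolynomial (Fin N) ℂ) :
    Ideal (MvPolynomial (Fin N) ℂ) :=
  Ideal.span (Set.range fun i => pderiv i F)

/-- The cubic `Q = Σ_{0 ≤ i < j < k ≤ n} x_i x_j x_k` in `n+1` variables. -/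
noncomputable def elemCubic (n : ℕ) : MvPolynomial (Fin (n + 1)) ℂ :=
  ∑ s ∈ Finset.powersetCard 3 Finset.univ, ∏ i ∈ s, X i


section Abstract

variable {A : Type*} [CommRing A] [Algebra ℂ A]

lemma aux_e_mul {N : ℕ} (x : Fin N → A) (h : ∀ i, x i ^ 2 = (∑ j, x j) * x i)
    (I : Finset (Fin N)) :
    (∑ j, x j) * ∏ i ∈ I, x i =
      (I.card : ℂ) • ((∑ j, x j) * ∏ i ∈ I, x i) + ∑ j ∈ Iᶜ, ∏ i ∈ insert j I, x i := by
  conv_lhs => rw [Finset.sum_mul, ← Finset.sum_add_sum_compl I]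
  congr 1
  · rw [Finset.sum_congr rfl (g := fun _ => (∑ j, x j) * ∏ i ∈ I, x i)]
    · rw [Finset.sum_const, Nat.cast_smul_eq_nsmul]
    · intro j hj
      rw [← Finset.mul_prod_erase I x hj, ← mul_assoc, ← mul_assoc, ← h j, sq]
  · refine Finset.sum_congr rfl fun j hj => ?_
    rw [Finset.prod_insert (by simpa using hj)]

lemma aux_double {N : ℕ} (y : Fin N → A) (I : Finset (Fin N)) (d : ℕ) (hd : I.card + d + 1 = N) :
    ∑ j ∈ Iᶜ, ∑ m ∈ (insert j I)ᶜ, y m = (d : ℂ) • ∑ m ∈ Iᶜ, y m := by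
  have h1 : ∀ j ∈ Iᶜ, ∑ m ∈ (insert j I)ᶜ, y m = ∑ m ∈ Iᶜ, y m - y j := by
    intro j hj
    rw [Finset.compl_insert, Finset.sum_erase_eq_sub hj]
  rw [Finset.sum_congr rfl h1, Finset.sum_sub_distrib, Finset.sum_const, Finset.card_compl,
    Fintype.card_fin]
  have : N - I.card = d + 1 := by omega
  rw [this, succ_nsmul, Nat.cast_smul_eq_nsmul]
  abel

lemma aux_desc {n : ℕ} (x : Fin (n + 1) → A) (h : ∀ i, x i ^ 2 = (∑ j, x j) * x i) (d : ℕ) :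
    d + 2 ≤ n → ∃ c : ℂ, c ≠ 0 ∧ ∀ I : Finset (Fin (n + 1)), I.card + d = n →
      (∑ j, x j) ^ d * ∏ i ∈ I, x i = c • ∑ m ∈ Iᶜ, ∏ i ∈ ({m} : Finset (Fin (n + 1)))ᶜ, x i := by
  induction d with
  | zero =>
    intro _
    refine ⟨1, one_ne_zero, fun I hI => ?_⟩
    have h1 : Iᶜ.card = 1 := by
      rw [Finset.card_compl, Fintype.card_fin]; omega
    obtain ⟨m, hm⟩ := Finset.card_eq_one.mp h1
    rw [hm, Finset.sum_singleton, ← hm, compl_compl]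
    simp
  | succ d ih =>
    intro hd
    obtain ⟨c, hc, hI⟩ := ih (by omega)
    obtain ⟨k, hk⟩ : ∃ k : ℕ, n = k + 2 + (d + 1) := ⟨n - (d + 3), by omega⟩
    have hk0 : (k : ℂ) + 1 ≠ 0 := by exact_mod_cast Nat.succ_ne_zero k
    have hd0 : (d : ℂ) + 1 ≠ 0 := by exact_mod_cast Nat.succ_ne_zero d
    refine ⟨-(c * (d + 1) / (k + 1)), by
      simp only [ne_eq, neg_eq_zero, div_eq_zero_iff, mul_eq_zero]; tauto, fun I hIc => ?_⟩
    have hcard : I.card = k + 2 := by omega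
    have e1 := congrArg (fun z => (∑ j, x j) ^ d * z) (aux_e_mul x h I)
    simp only [mul_add, Finset.mul_sum, mul_smul_comm] at e1
    simp only [← Finset.mul_sum] at e1
    rw [Finset.mul_sum] at e1
    have e2 : ∑ j ∈ Iᶜ, (∑ j, x j) ^ d * ∏ i ∈ insert j I, x i
        = ∑ j ∈ Iᶜ, c • ∑ m ∈ (insert j I)ᶜ, ∏ i ∈ ({m} : Finset (Fin (n + 1)))ᶜ, x i := by
      refine Finset.sum_congr rfl fun j hj => hI _ ?_
      rw [Finset.card_insert_of_notMem (by simpa using hj)]; omega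
    rw [e2, ← Finset.smul_sum, aux_double _ I (d + 1) (by omega), hcard, ← mul_assoc,
      ← pow_succ] at e1
    set T := ∑ m ∈ Iᶜ, ∏ i ∈ ({m} : Finset (Fin (n + 1)))ᶜ, x i
    set E := (∑ j, x j) ^ (d + 1) * ∏ i ∈ I, x i
    have e3 : ((k : ℂ) + 1) • E = ((k : ℂ) + 1) • (-(c * (d + 1) / (k + 1)) • T) := by
      rw [smul_smul, show ((k : ℂ) + 1) * (-(c * (d + 1) / (k + 1))) = -(c * (d + 1)) by
        field_simp]
      push_cast at e1
      linear_combination (norm := module) (-1 : ℂ) • e1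
    have := congrArg (fun z => ((k : ℂ) + 1)⁻¹ • z) e3
    simpa only [smul_smul, ← mul_assoc, inv_mul_cancel₀ hk0, one_mul, one_smul] using this

lemma aux_y {n : ℕ} (hn : 2 ≤ n) (x : Fin (n + 1) → A)
    (h : ∀ i, x i ^ 2 = (∑ j, x j) * x i) (m : Fin (n + 1)) :
    ∏ i ∈ ({m} : Finset (Fin (n + 1)))ᶜ, x i = 0 := by
  obtain ⟨c, hc, hI⟩ := aux_desc x h (n - 2) (by omega)
  set y : Fin (n + 1) → A := fun m => ∏ i ∈ ({m} : Finset (Fin (n + 1)))ᶜ, x i with hy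
  have key : ∀ i, ∑ m ∈ ({i} : Finset (Fin (n + 1)))ᶜ, y m = 0 := by
    intro i
    have h1 : ∑ j ∈ ({i} : Finset (Fin (n + 1)))ᶜ, (∑ j, x j) ^ (n - 2) * ∏ l ∈ insert j {i}, x l
        = 0 := by
      rw [← Finset.mul_sum]
      have := aux_e_mul x h {i}
      simp only [Finset.card_singleton, Nat.cast_one, one_smul] at this
      rw [left_eq_add.mp this, mul_zero]
    rw [Finset.sum_congr rfl (g := fun j => c • ∑ m ∈ (insert j {i})ᶜ, y m)] at h1
    · rw [← Finset.smul_sum, aux_double y {i} (n - 1) (by simp; omega), smul_smul] at h1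
      have h2 : c * ((n - 1 : ℕ) : ℂ) ≠ 0 :=
        mul_ne_zero hc (by exact_mod_cast (by omega : n - 1 ≠ 0))
      have := congrArg (fun z => (c * ((n - 1 : ℕ) : ℂ))⁻¹ • z) h1
      simpa only [smul_smul, inv_mul_cancel₀ h2, one_smul, smul_zero] using this
    · intro j hj
      refine hI _ ?_
      rw [Finset.card_insert_of_notMem (by simpa using hj), Finset.card_singleton]; omega
  have h3 : ∀ i, y i = ∑ m, y m := by
    intro i
    rw [← Finset.sum_add_sum_compl {i} y, key i, Finset.sum_singleton, add_zero]
  have h4 : ∑ m, y m = 0 := by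
    have h5 : ∑ m, y m = (n + 1) • ∑ m, y m := by
      conv_lhs => rw [Finset.sum_congr rfl (fun i _ => h3 i)]
      simp
    have h6 : (n : ℂ) • ∑ m, y m = 0 := by
      rw [Nat.cast_smul_eq_nsmul]
      rw [succ_nsmul] at h5
      exact right_eq_add.mp h5
    have h2 : (n : ℂ) ≠ 0 := by exact_mod_cast (by omega : n ≠ 0)
    have := congrArg (fun z => (n : ℂ)⁻¹ • z) h6
    simpa only [smul_smul, inv_mul_cancel₀ h2, one_smul, smul_zero] using this
  exact (h3 m).trans h4

lemma aux_pow (a e : A) (h : a ^ 2 = e * a) (k : ℕ) : a ^ (k + 1) = e ^ k * a := by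
  induction k with
  | zero => simp
  | succ k ih => rw [pow_succ, ih, mul_assoc, ← sq, h, pow_succ, mul_assoc]

lemma aux_monomial {n : ℕ} (hn : 2 ≤ n) (x : Fin (n + 1) → A)
    (h : ∀ i, x i ^ 2 = (∑ j, x j) * x i) (e : Fin (n + 1) →₀ ℕ)
    (he : (e.sum fun _ v => v) = n) (hs : 2 ≤ e.support.card) :
    ∏ i ∈ e.support, x i ^ e i = 0 := by
  have h1 : ∏ i ∈ e.support, x i ^ e i
      = (∑ j, x j) ^ (∑ i ∈ e.support, (e i - 1)) * ∏ i ∈ e.support, x i := by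
    rw [← Finset.prod_pow_eq_pow_sum, ← Finset.prod_mul_distrib]
    refine Finset.prod_congr rfl fun i hi => ?_
    rw [← aux_pow (x i) _ (h i)]
    congr 1
    have := Finsupp.mem_support_iff.mp hi
    omega
  have h2 : e.support.card + ∑ i ∈ e.support, (e i - 1) = n := by
    rw [Finset.card_eq_sum_ones, ← Finset.sum_add_distrib]
    refine Eq.trans ?_ he
    refine Finset.sum_congr rfl fun i hi => ?_
    change 1 + (e i - 1) = e i
    have := Finsupp.mem_support_iff.mp hi
    omega
  obtain ⟨c, -, hI⟩ := aux_desc x h (∑ i ∈ e.support, (e i - 1)) (by omega)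
  rw [h1, hI _ h2, Finset.sum_eq_zero fun m _ => aux_y hn x h m, smul_zero]

end Abstract

lemma aux_newton (n : ℕ) : 6 * elemCubic n =
    (∑ i, X i) ^ 3 - 3 * (∑ i, X i) * (∑ i, X i ^ 2) + 2 * ∑ i, X i ^ 3 := by
  have h1 := MvPolynomial.mul_esymm_eq_sum (Fin (n + 1)) ℂ 1
  have h2 := MvPolynomial.mul_esymm_eq_sum (Fin (n + 1)) ℂ 2
  have h3 := MvPolynomial.mul_esymm_eq_sum (Fin (n + 1)) ℂ 3
  have a1 : (Finset.HasAntidiagonal.antidiagonal 1).filter (fun a : ℕ × ℕ => a.1 < 1) = {(0, 1)} := by decide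
  have a2 : (Finset.HasAntidiagonal.antidiagonal 2).filter (fun a : ℕ × ℕ => a.1 < 2) = {(0, 2), (1, 1)} := by
    decide
  have a3 : (Finset.HasAntidiagonal.antidiagonal 3).filter (fun a : ℕ × ℕ => a.1 < 3)
      = {(0, 3), (1, 2), (2, 1)} := by decide
  rw [a1] at h1
  rw [a2] at h2
  rw [a3] at h3
  have hQ : elemCubic n = esymm (Fin (n + 1)) ℂ 3 := rfl
  simp [psum] at h1 h2 h3
  rw [hQ]
  linear_combination 2 * h3 + (∑ i, X i) * h2

lemma aux_pderiv (n : ℕ) (i : Fin (n + 1)) : 2 * pderiv i (elemCubic n) =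
    (∑ i, X i) ^ 2 - (∑ i, X i ^ 2) - 2 * (∑ i, X i) * X i + 2 * X i ^ 2 := by
  have h := congrArg (pderiv i) (aux_newton n)
  have c6 : (6 : MvPolynomial (Fin (n + 1)) ℂ) = C 6 := (map_ofNat C 6).symm
  have c3 : (3 : MvPolynomial (Fin (n + 1)) ℂ) = C 3 := (map_ofNat C 3).symm
  have c2 : (2 : MvPolynomial (Fin (n + 1)) ℂ) = C 2 := (map_ofNat C 2).symm
  have s1 : pderiv i (∑ j, X j : MvPolynomial (Fin (n + 1)) ℂ) = 1 := by
    simp [map_sum, pderiv_X, Pi.single_apply]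
  have s2 : pderiv i (∑ j, X j ^ 2 : MvPolynomial (Fin (n + 1)) ℂ) = 2 * X i := by
    simp [map_sum, pderiv_X, Pi.single_apply, pderiv_pow]
  have s3 : pderiv i (∑ j, X j ^ 3 : MvPolynomial (Fin (n + 1)) ℂ) = 3 * X i ^ 2 := by
    simp [map_sum, pderiv_X, Pi.single_apply, pderiv_pow]
  have k6 : pderiv i (6 : MvPolynomial (Fin (n + 1)) ℂ) = 0 := by rw [c6, pderiv_C]
  have k3 : pderiv i (3 : MvPolynomial (Fin (n + 1)) ℂ) = 0 := by rw [c3, pderiv_C]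
  have k2 : pderiv i (2 : MvPolynomial (Fin (n + 1)) ℂ) = 0 := by rw [c2, pderiv_C]
  simp only [map_add, map_sub, pderiv_mul, pderiv_pow, s1, s2, s3, k6, k3, k2] at h
  have h3 : (3 : MvPolynomial (Fin (n + 1)) ℂ) ≠ 0 := by norm_num
  apply mul_left_cancel₀ h3
  push_cast at h
  linear_combination h

lemma aux_rel (n : ℕ) (hn : 2 ≤ n) (i : Fin (n + 1)) :
    (Ideal.Quotient.mk (jacobianIdeal (elemCubic n)) (X i)) ^ 2 =
      (∑ j, Ideal.Quotient.mk (jacobianIdeal (elemCubic n)) (X j)) *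
        Ideal.Quotient.mk (jacobianIdeal (elemCubic n)) (X i) := by
  set J := jacobianIdeal (elemCubic n) with hJ
  rw [← map_sum, ← map_pow, ← map_mul, Ideal.Quotient.eq]
  have hmem : ∀ i, pderiv i (elemCubic n) ∈ J := fun i => Ideal.subset_span ⟨i, rfl⟩
  have h1 : ((∑ i, X i) ^ 2 - ∑ i, X i ^ 2 : MvPolynomial (Fin (n + 1)) ℂ) ∈ J := by
    have h2 : ∑ i, 2 * pderiv i (elemCubic n) ∈ J :=
      J.sum_mem fun i _ => J.mul_mem_left _ (hmem i)
    simp only [aux_pderiv, Finset.sum_add_distrib, Finset.sum_sub_distrib, Finset.sum_const,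
      ← Finset.mul_sum, Finset.card_univ, Fintype.card_fin] at h2
    have h3 : (n : ℂ) - 1 ≠ 0 := by
      have : (n : ℂ) ≠ 1 := by exact_mod_cast (by omega : n ≠ 1)
      exact sub_ne_zero.mpr this
    have h4 := J.mul_mem_left (C ((n : ℂ) - 1)⁻¹) h2
    convert h4 using 1
    have h5 : (C ((n : ℂ) - 1)⁻¹ : MvPolynomial (Fin (n + 1)) ℂ) * ((n : MvPolynomial (Fin (n + 1)) ℂ) - 1) = 1 := by
      rw [show (n : MvPolynomial (Fin (n + 1)) ℂ) - 1 = C ((n : ℂ) - 1) by simp, ← C_mul,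
        inv_mul_cancel₀ h3, C_1]
    simp only [nsmul_eq_mul]
    push_cast
    linear_combination (-((∑ i, X i) ^ 2 - ∑ i, X i ^ 2)) * h5
  have h6 := J.mul_mem_left (C (1 / 2)) (J.sub_mem (J.mul_mem_left 2 (hmem i)) h1)
  rw [aux_pderiv] at h6
  convert h6 using 1
  have h7 : (C (1 / 2) : MvPolynomial (Fin (n + 1)) ℂ) * 2 = 1 := by
    rw [show (2 : MvPolynomial (Fin (n + 1)) ℂ) = C 2 from (map_ofNat C 2).symm, ← C_mul]; simp
  linear_combination (-(X i ^ 2 - (∑ i, X i) * X i)) * h7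

lemma aux_eval (n : ℕ) (l : Fin (n + 1)) (P : MvPolynomial (Fin (n + 1)) ℂ)
    (hP : P ∈ jacobianIdeal (elemCubic n)) : eval (Pi.single l (1 : ℂ)) P = 0 := by
  have : jacobianIdeal (elemCubic n) ≤ RingHom.ker (eval (Pi.single l (1 : ℂ))) := by
    rw [jacobianIdeal, Ideal.span_le]
    rintro _ ⟨i, rfl⟩
    have h := congrArg (eval (Pi.single l (1 : ℂ))) (aux_pderiv n i)
    simp only [SetLike.mem_coe, RingHom.mem_ker]
    simp only [map_add, map_sub, map_mul, map_pow, map_sum, eval_X, map_ofNat] at h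
    have s1 : ∑ j, (Pi.single l (1 : ℂ) : Fin (n + 1) → ℂ) j = 1 := by simp
    have s2 : ∑ j, (Pi.single l (1 : ℂ) : Fin (n + 1) → ℂ) j ^ 2 = 1 := by
      simp [Pi.single_apply, ite_pow]
    rw [s1, s2] at h
    by_cases hi : i = l
    · subst hi
      simpa using h
    · simpa [Pi.single_apply, hi] using h
  exact this hP

/-- The degree-`n` part `J_{Q,n}` of the Jacobian ideal of `Q` is the span of all monomials
of degree `n` other than the pure powers `x₀ⁿ, …, x_nⁿ`. -/
theorem elemCubic_jacobian_degree_n (n : ℕ) (hn : 2 ≤ n) :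
    Submodule.restrictScalars ℂ (jacobianIdeal (elemCubic n)) ⊓
        homogeneousSubmodule (Fin (n + 1)) ℂ n =
      Submodule.span ℂ {P : MvPolynomial (Fin (n + 1)) ℂ |
        ∃ e : Fin (n + 1) →₀ ℕ, (e.sum fun _ v => v) = n ∧
          (∀ l, e ≠ Finsupp.single l n) ∧ P = monomial e 1} := by
  apply le_antisymm
  · rintro P ⟨hJ, hH⟩
    have hJ' : P ∈ jacobianIdeal (elemCubic n) := hJ
    have hH' : P.IsHomogeneous n := hH
    rw [P.as_sum]
    refine Submodule.sum_mem _ fun e he => ?_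
    rw [show monomial e (coeff e P) = coeff e P • monomial e (1 : ℂ) by
      rw [smul_monomial, smul_eq_mul, mul_one]]
    have hdeg : ∀ e ∈ P.support, (e.sum fun _ v => v) = n := fun e he => by
      have := hH' (mem_support_iff.mp he)
      rwa [Finsupp.weight_apply, Finsupp.sum_congr (g2 := fun _ v => v) (by simp)] at this
    refine Submodule.smul_mem _ _ (Submodule.subset_span ⟨e, hdeg e he, ?_, rfl⟩)
    rintro l rfl
    have h0 := aux_eval n l P hJ'
    rw [eval_eq, Finset.sum_eq_single_of_mem _ he] at h0
    · rw [Finset.prod_eq_one, mul_one] at h0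
      · exact mem_support_iff.mp he h0
      · intro i hi
        have := Finsupp.support_single_subset hi
        rw [Finset.mem_singleton] at this
        subst this
        simp
    · intro e' he' hne
      by_cases hsub : e'.support ⊆ {l}
      · exfalso
        apply hne
        obtain ⟨b, hb⟩ := Finsupp.support_subset_singleton'.mp hsub
        have := hdeg e' he'
        rw [hb, Finsupp.sum_single_index rfl] at this
        rw [hb, this]
      · obtain ⟨i, hi, hil⟩ := Finset.not_subset.mp hsub
        rw [Finset.prod_eq_zero hi, mul_zero]
        rw [Finset.mem_singleton] at hil
        rw [Pi.single_eq_of_ne hil, zero_pow (Finsupp.mem_support_iff.mp hi)]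
  · rw [Submodule.span_le]
    rintro _ ⟨e, he, hne, rfl⟩
    refine ⟨?_, ?_⟩
    · change monomial e (1 : ℂ) ∈ jacobianIdeal (elemCubic n)
      rw [← Ideal.Quotient.eq_zero_iff_mem, monomial_eq, C_1, one_mul, Finsupp.prod, map_prod]
      simp only [map_pow]
      refine aux_monomial hn _ (aux_rel n hn) e he ?_
      by_contra hcard
      obtain ⟨l, hl⟩ := Finset.card_le_one_iff_subset_singleton.mp (by omega : e.support.card ≤ 1)
      obtain ⟨b, hb⟩ := Finsupp.support_subset_singleton'.mp hl
      rw [hb, Finsupp.sum_single_index rfl] at he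
      exact hne l (by rw [hb, he])
    · exact isHomogeneous_monomial _ he
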